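/- Martingale optimal transport duality (no duality gap): let μ1, μ2 be Borel probability measures on ℝ^d with finite first moments such that μ1 is dominated by μ2 in the convex order, and let c : ℝ^d × ℝ^d → ℝ be upper semicontinuous with |c(s1, s2)| ≤ K(1 + |s1| + |s2|) for some constant K. Then the supremum of ∫ c dP over all martingale couplings P of (μ1, μ2) equals the infimum of ∫ u1 dμ1 + ∫ u2 dμ2 over all triples (u1, u2, h) with u1 ∈ L¹(μ1), u2 ∈ L¹(μ2), h : ℝ^d → ℝ^d bounded continuous, satisfying u1(s1) + u2(s2) + h(s1)·(s2 − s1) ≥ c(s1, s2) for all (s1, s2) ∈ ℝ^d × ℝ^d. -/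

import Mathlib

open MeasureTheory BoundedContinuousFunction RealInnerProductSpace

noncomputable section

/-- A coupling of `μ1` and `μ2`. -/
def IsCoupling {d : ℕ} (μ1 μ2 : Measure (EuclideanSpace ℝ (Fin d)))
    (P : Measure (EuclideanSpace ℝ (Fin d) × EuclideanSpace ℝ (Fin d))) : Prop :=
  P.map Prod.fst = μ1 ∧ P.map Prod.snd = μ2

/-- A martingale coupling: a coupling with finite first moments such that
`∫ f(s1)·(s2 - s1) dP = 0` for every bounded continuous `f`. -/
def IsMartingaleCoupling {d : ℕ} (μ1 μ2 : Measure (EuclideanSpace ℝ (Fin d)))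
    (P : Measure (EuclideanSpace ℝ (Fin d) × EuclideanSpace ℝ (Fin d))) : Prop :=
  IsCoupling μ1 μ2 P ∧
  Integrable (fun p : EuclideanSpace ℝ (Fin d) × EuclideanSpace ℝ (Fin d) => ‖p.1‖ + ‖p.2‖) P ∧
  ∀ f : EuclideanSpace ℝ (Fin d) →ᵇ EuclideanSpace ℝ (Fin d),
    ∫ p : EuclideanSpace ℝ (Fin d) × EuclideanSpace ℝ (Fin d), ⟪f p.1, p.2 - p.1⟫ ∂P = 0

open Filter Topology
open scoped CompactlySupported

/-- A sublinear functional is attained at any given point by a linear functional below it. -/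
theorem exists_linearMap_eq_of_sublinear {V : Type*} [AddCommGroup V] [Module ℝ V] (N : V → ℝ)
    (N_hom : ∀ t : ℝ, 0 < t → ∀ x, N (t • x) = t * N x)
    (N_add : ∀ x y, N (x + y) ≤ N x + N y) (x : V) :
    ∃ g : V →ₗ[ℝ] ℝ, g x = N x ∧ ∀ y, g y ≤ N y := by
  have N_zero : N 0 = 0 := by
    have h := N_hom 2 (by norm_num) 0
    rw [smul_zero] at h
    linarith
  have H : ∀ t : ℝ, t • x = 0 → (RingHom.id ℝ t) • N x = 0 := by
    intro t ht
    rcases smul_eq_zero.1 ht with rfl | rfl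
    · simp
    · simp [N_zero]
  obtain ⟨g, hg, hgN⟩ := exists_extension_of_le_sublinear
    (LinearPMap.mkSpanSingleton' x (N x) H) N N_hom N_add (by
      rintro ⟨y, hy⟩
      obtain ⟨t, rfl⟩ := Submodule.mem_span_singleton.1 hy
      rw [LinearPMap.mkSpanSingleton'_apply]
      simp only [RingHom.id_apply, smul_eq_mul]
      rcases lt_trichotomy t 0 with ht | rfl | ht
      · have h1 := N_hom (-t) (by linarith) x
        have h2 := N_add (t • x) (-t • x)
        rw [← add_smul, add_neg_cancel, zero_smul, N_zero] at h2
        linarith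
      · simp [N_zero]
      · rw [N_hom t ht])
  refine ⟨g, ?_, hgN⟩
  exact (hg ⟨x, Submodule.mem_span_singleton_self x⟩).trans
    (LinearPMap.mkSpanSingleton'_apply_self x (N x) H _)

/-- The functions on `E × E` of at most linear growth. -/
def linearGrowth (E : Type*) [NormedAddCommGroup E] : Submodule ℝ (E × E → ℝ) where
  carrier := {f | ∃ K : ℝ, ∀ p, |f p| ≤ K * (1 + ‖p.1‖ + ‖p.2‖)}
  add_mem' := by
    rintro f g ⟨K, hK⟩ ⟨M, hM⟩
    refine ⟨K + M, fun p => (abs_add_le _ _).trans ?_⟩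
    rw [add_mul]
    exact add_le_add (hK p) (hM p)
  zero_mem' := ⟨0, fun p => by simp⟩
  smul_mem' := by
    rintro t f ⟨K, hK⟩
    refine ⟨|t| * K, fun p => ?_⟩
    rw [Pi.smul_apply, smul_eq_mul, abs_mul, mul_assoc]
    exact mul_le_mul_of_nonneg_left (hK p) (abs_nonneg t)

section Growth

variable {E : Type*} [NormedAddCommGroup E]

theorem mem_linearGrowth_of_bounded {f : E × E → ℝ} {C : ℝ} (hf : ∀ p, |f p| ≤ C) :
    f ∈ linearGrowth E := by
  refine ⟨C, fun p => (hf p).trans (le_mul_of_one_le_right ((abs_nonneg _).trans (hf p)) ?_)⟩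
  have := norm_nonneg p.1
  have := norm_nonneg p.2
  linarith

theorem mem_linearGrowth_of_abs_le {f g : E × E → ℝ} (hg : g ∈ linearGrowth E)
    (hfg : ∀ p, |f p| ≤ |g p|) : f ∈ linearGrowth E := by
  obtain ⟨K, hK⟩ := hg
  exact ⟨K, fun p => (hfg p).trans (hK p)⟩

/-- The excess of the two norms over the level `n`. -/
def normExcess (n : ℕ) (p : E × E) : ℝ := max (‖p.1‖ - n) 0 + max (‖p.2‖ - n) 0

theorem normExcess_nonneg (n : ℕ) (p : E × E) : 0 ≤ normExcess n p := by
  unfold normExcess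
  positivity

theorem normExcess_mem_linearGrowth (n : ℕ) : normExcess n ∈ linearGrowth E := by
  refine ⟨1, fun p => ?_⟩
  rw [abs_of_nonneg (normExcess_nonneg n p)]
  have h1 : max (‖p.1‖ - n) 0 ≤ ‖p.1‖ := max_le (by simp) (norm_nonneg _)
  have h2 : max (‖p.2‖ - n) 0 ≤ ‖p.2‖ := max_le (by simp) (norm_nonneg _)
  unfold normExcess
  linarith

theorem weight_le_normExcess {n : ℕ} (hn : 1 ≤ n) {p : E × E} (hp : 2 * n < ‖p‖) :
    1 + ‖p.1‖ + ‖p.2‖ ≤ 6 * normExcess n p := by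
  have hn' : (1 : ℝ) ≤ n := by exact_mod_cast hn
  have h1 := le_max_left (‖p.1‖ - n) 0
  have h2 := le_max_left (‖p.2‖ - n) 0
  have h3 := le_max_right (‖p.1‖ - n) 0
  have h4 := le_max_right (‖p.2‖ - n) 0
  unfold normExcess
  rw [Prod.norm_def] at hp
  rcases le_total ‖p.1‖ ‖p.2‖ with h | h
  · rw [max_eq_right h] at hp
    linarith
  · rw [max_eq_left h] at hp
    linarith

theorem integrable_of_lipschitz [MeasurableSpace E] [BorelSpace E] [SecondCountableTopology E]
    {μ : Measure E} [IsFiniteMeasure μ]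
    (hμ : Integrable (fun x => ‖x‖) μ) {φ : E → ℝ} {C : NNReal} (hφ : LipschitzWith C φ) :
    Integrable φ μ := by
  refine ((integrable_const |φ 0|).add (hμ.const_mul (C : ℝ))).mono'
    hφ.continuous.aestronglyMeasurable (Eventually.of_forall fun x => ?_)
  have h1 := hφ.dist_le_mul x 0
  rw [Real.dist_eq, dist_zero_right] at h1
  have h2 := abs_sub_abs_le_abs_sub (φ x) (φ 0)
  simp only [Real.norm_eq_abs, Pi.add_apply]
  linarith

theorem tendsto_integral_norm_sub_nat [MeasurableSpace E] [BorelSpace E]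
    [SecondCountableTopology E] {μ : Measure E} (hμ : Integrable (fun x => ‖x‖) μ) :
    Tendsto (fun n : ℕ => ∫ x, max (‖x‖ - n) 0 ∂μ) atTop (𝓝 0) := by
  have h := tendsto_integral_of_dominated_convergence (μ := μ)
    (F := fun (n : ℕ) x => max (‖x‖ - n) 0) (f := fun _ => (0 : ℝ)) (fun x => ‖x‖)
    (fun n => by
      have : Continuous fun x : E => max (‖x‖ - n) 0 := by fun_prop
      exact this.aestronglyMeasurable) hμ
    (fun n => Eventually.of_forall fun x => by
      rw [Real.norm_of_nonneg (le_max_right _ _)]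
      exact max_le (by simp) (norm_nonneg _))
    (Eventually.of_forall fun x => by
      refine tendsto_const_nhds.congr' ?_
      filter_upwards [eventually_ge_atTop ⌈‖x‖⌉₊] with n hn
      rw [max_eq_right (sub_nonpos.2 (Nat.ceil_le.1 hn))])
  simpa using h

/-- An upper semicontinuous function of linear growth is the pointwise limit of continuous
functions above it of uniformly linear growth. -/
theorem exists_continuous_tendsto_of_upperSemicontinuous {c : E × E → ℝ}
    (hc : UpperSemicontinuous c) (hc' : c ∈ linearGrowth E) :
    ∃ (M : ℝ) (F : ℕ → E × E → ℝ), (∀ n, Continuous (F n)) ∧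
      (∀ n p, |F n p| ≤ M * (1 + ‖p.1‖ + ‖p.2‖)) ∧ (∀ n p, c p ≤ F n p) ∧
      ∀ p, Tendsto (fun n => F n p) atTop (𝓝 (c p)) := by
  obtain ⟨K, hK⟩ := hc'
  have hK0 : 0 ≤ K := by
    have := (abs_nonneg _).trans (hK 0)
    simpa using this
  have hub : ∀ (n : ℕ) (x y : E × E),
      c y - (2 * K + n) * dist x y ≤ K + 2 * K * ‖x‖ - n * dist x y := by
    intro n x y
    have h1 : ‖y‖ ≤ ‖x‖ + dist x y := by
      rw [dist_comm, dist_eq_norm]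
      exact norm_le_norm_add_norm_sub' y x
    have h2 : K * (1 + ‖y.1‖ + ‖y.2‖) ≤ K * (1 + 2 * (‖x‖ + dist x y)) := by
      refine mul_le_mul_of_nonneg_left ?_ hK0
      have := norm_fst_le y
      have := norm_snd_le y
      linarith
    have := (le_abs_self _).trans (hK y)
    linarith
  have hub' : ∀ (n : ℕ) (x y : E × E), c y - (2 * K + n) * dist x y ≤ K + 2 * K * ‖x‖ := by
    intro n x y
    have : (0 : ℝ) ≤ n * dist x y := by positivity
    linarith [hub n x y]
  let F : ℕ → E × E → ℝ := fun n x => ⨆ y, (c y - (2 * K + n) * dist x y)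
  have hF_ge : ∀ n x y, c y - (2 * K + n) * dist x y ≤ F n x := fun n x y =>
    le_ciSup (f := fun y => c y - (2 * K + n) * dist x y)
      ⟨_, Set.forall_mem_range.2 (hub' n x)⟩ y
  have hF_le : ∀ n x, F n x ≤ K + 2 * K * ‖x‖ := fun n x => ciSup_le (hub' n x)
  have hcF : ∀ n x, c x ≤ F n x := fun n x => by simpa using hF_ge n x x
  refine ⟨2 * K, F, fun n => ?_, fun n x => ?_, hcF, fun x => ?_⟩
  · have : LipschitzWith (2 * K + n).toNNReal (F n) := by
      refine LipschitzWith.of_le_add_mul _ fun x y => ciSup_le fun z => ?_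
      rw [Real.coe_toNNReal _ (by positivity)]
      have h1 := mul_le_mul_of_nonneg_left (dist_triangle_left y z x)
        (by positivity : 0 ≤ 2 * K + n)
      linarith [hF_ge n y z]
    exact this.continuous
  · have h1 : ‖x‖ ≤ ‖x.1‖ + ‖x.2‖ := max_le_add_of_nonneg (norm_nonneg _) (norm_nonneg _)
    have h2 := mul_le_mul_of_nonneg_left h1 (by positivity : 0 ≤ 2 * K)
    have h3 : 0 ≤ K * (1 + ‖x.1‖ + ‖x.2‖) := by positivity
    have h4 := (abs_le.1 (hK x)).1
    rw [abs_le]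
    constructor <;> linarith [hF_le n x, hcF n x]
  · rw [tendsto_order]
    refine ⟨fun a ha => Eventually.of_forall fun n => ha.trans_le (hcF n x), fun a ha => ?_⟩
    obtain ⟨b, hb, hba⟩ := exists_between ha
    obtain ⟨δ, hδ, hball⟩ := Metric.eventually_nhds_iff.1 (hc x b hb)
    obtain ⟨m, hm⟩ := exists_nat_gt ((K + 2 * K * ‖x‖ - b) / δ)
    filter_upwards [eventually_ge_atTop m] with n hn
    refine (ciSup_le fun y => ?_).trans_lt hba
    rcases lt_or_ge (dist y x) δ with hy | hy
    · have : 0 ≤ (2 * K + n) * dist x y := by positivity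
      linarith [hball hy]
    · rw [div_lt_iff₀ hδ] at hm
      have h1 : (m : ℝ) * δ ≤ n * dist x y := by
        rw [dist_comm]
        gcongr
      linarith [hub n x y]

end Growth

section Representation

variable {E : Type*} [NormedAddCommGroup E] [NormedSpace ℝ E] [FiniteDimensional ℝ E]
  [MeasurableSpace E] [BorelSpace E]

/-- A positive functional on functions of linear growth whose mass does not escape to infinity is
given on continuous functions by integration against a measure with finite first moments. -/
theorem exists_measure_integral_eq (L : (E × E → ℝ) →ₗ[ℝ] ℝ)
    (hpos : ∀ f ∈ linearGrowth E, (∀ p, 0 ≤ f p) → 0 ≤ L f)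
    (htail : Tendsto (fun n => L (normExcess n)) atTop (𝓝 0)) :
    ∃ P : Measure (E × E), Integrable (fun p : E × E => 1 + ‖p.1‖ + ‖p.2‖) P ∧
      ∀ f ∈ linearGrowth E, Continuous f → ∫ p, f p ∂P = L f := by
  have : ProperSpace E := FiniteDimensional.proper_real E
  have hmono : ∀ f ∈ linearGrowth E, ∀ g ∈ linearGrowth E, (∀ p, f p ≤ g p) → L f ≤ L g := by
    intro f hf g hg hfg
    have := hpos (g - f) (sub_mem hg hf) (fun p => sub_nonneg.2 (hfg p))
    rw [map_sub] at this
    linarith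
  have hcc : ∀ f : C_c(E × E, ℝ), ⇑f ∈ linearGrowth E := by
    intro f
    obtain ⟨C, hC⟩ := f.hasCompactSupport.exists_bound_of_continuous f.continuous
    exact mem_linearGrowth_of_bounded hC
  let Λ₀ : C_c(E × E, ℝ) →ₗ[ℝ] ℝ :=
    { toFun := fun f => L f
      map_add' := fun f g => by rw [CompactlySupportedContinuousMap.coe_add, map_add]
      map_smul' := fun t f => by
        rw [CompactlySupportedContinuousMap.coe_smul, map_smul, RingHom.id_apply] }
  let Λ : C_c(E × E, ℝ) →ₚ[ℝ] ℝ := PositiveLinearMap.mk₀ Λ₀ (fun f hf => hpos f (hcc f) hf)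
  let P : Measure (E × E) := RealRMK.rieszMeasure Λ
  have hP : ∀ f : E × E → ℝ, Continuous f → HasCompactSupport f →
      Integrable f P ∧ ∫ p, f p ∂P = L f := fun f hf hf' =>
    ⟨hf.integrable_of_hasCompactSupport hf', RealRMK.integral_rieszMeasure Λ ⟨⟨f, hf⟩, hf'⟩⟩
  have hχ : ∀ n : ℕ, ∃ χ : C(E × E, ℝ), Set.EqOn χ 1 (Metric.closedBall 0 (2 * n)) ∧
      HasCompactSupport χ ∧ ∀ p, χ p ∈ Set.Icc (0 : ℝ) 1 := by
    intro n
    obtain ⟨χ, h1, -, h2, h3⟩ := exists_continuous_one_zero_of_isCompact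
      (isCompact_closedBall (0 : E × E) (2 * n)) isClosed_empty (Set.disjoint_empty _)
    exact ⟨χ, h1, h2, h3⟩
  choose χ hχ_one hχ_supp hχ_mem using hχ
  have hχ_lim : ∀ (f : E × E → ℝ) (p : E × E),
      Tendsto (fun n => χ n p * f p) atTop (𝓝 (f p)) := by
    intro f p
    refine tendsto_const_nhds.congr' ?_
    filter_upwards [eventually_ge_atTop ⌈‖p‖⌉₊] with n hn
    have hn' : ‖p‖ ≤ n := Nat.ceil_le.1 hn
    rw [hχ_one n (by
      rw [mem_closedBall_zero_iff]
      have := norm_nonneg p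
      linarith), Pi.one_apply, one_mul]
  have hχ_le : ∀ (f : E × E → ℝ) n p, |χ n p * f p| ≤ |f p| := by
    intro f n p
    rw [abs_mul, abs_of_nonneg (hχ_mem n p).1]
    exact mul_le_of_le_one_left (abs_nonneg _) (hχ_mem n p).2
  have hχ_growth : ∀ f ∈ linearGrowth E, ∀ n, (fun p => χ n p * f p) ∈ linearGrowth E :=
    fun f hf n => mem_linearGrowth_of_abs_le hf (hχ_le f n)
  have hχ_int : ∀ (f : E × E → ℝ), Continuous f → ∀ n,
      Integrable (fun p => χ n p * f p) P ∧ ∫ p, χ n p * f p ∂P = L (fun p => χ n p * f p) :=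
    fun f hf n => hP _ ((χ n).continuous.mul hf) (hχ_supp n).mul_right
  have hχ_L : ∀ f ∈ linearGrowth E,
      Tendsto (fun n => L (fun p => χ n p * f p)) atTop (𝓝 (L f)) := by
    intro f hf
    obtain ⟨K, hK⟩ := id hf
    have hK0 : 0 ≤ K := by
      have := (abs_nonneg _).trans (hK 0)
      simpa using this
    rw [tendsto_iff_dist_tendsto_zero]
    refine squeeze_zero' (Eventually.of_forall fun _ => dist_nonneg) ?_
      (by simpa using htail.const_mul (6 * K))
    filter_upwards [eventually_ge_atTop 1] with n hn
    have hbound : ∀ p, |χ n p * f p - f p| ≤ 6 * K * normExcess n p := by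
      intro p
      rcases le_or_gt ‖p‖ (2 * n) with hp | hp
      · rw [hχ_one n (mem_closedBall_zero_iff.2 hp), Pi.one_apply, one_mul, sub_self, abs_zero]
        have := normExcess_nonneg n p
        positivity
      · have h1 : |χ n p * f p - f p| ≤ |f p| := by
          rw [← sub_one_mul, abs_mul]
          refine mul_le_of_le_one_left (abs_nonneg _) ?_
          have := hχ_mem n p
          rw [abs_le]
          constructor <;> linarith [this.1, this.2]
        calc _ ≤ K * (1 + ‖p.1‖ + ‖p.2‖) := h1.trans (hK p)
          _ ≤ K * (6 * normExcess n p) :=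
            mul_le_mul_of_nonneg_left (weight_le_normExcess hn hp) hK0
          _ = _ := by ring
    have hd : (fun p => χ n p * f p) - f ∈ linearGrowth E := sub_mem (hχ_growth f hf n) hf
    have he : (6 * K) • normExcess n ∈ linearGrowth E :=
      (linearGrowth E).smul_mem _ (normExcess_mem_linearGrowth n)
    rw [Real.dist_eq, ← map_sub, ← smul_eq_mul, ← map_smul, abs_le, ← map_neg]
    exact ⟨hmono _ (neg_mem he) _ hd fun p => (abs_le.1 (hbound p)).1,
      hmono _ hd _ he fun p => (abs_le.1 (hbound p)).2⟩
  have hw_mem : (fun p : E × E => 1 + ‖p.1‖ + ‖p.2‖) ∈ linearGrowth E :=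
    ⟨1, fun p => by rw [one_mul, abs_of_nonneg (by positivity)]⟩
  have hw_cont : Continuous (fun p : E × E => 1 + ‖p.1‖ + ‖p.2‖) := by fun_prop
  have hw : Integrable (fun p : E × E => 1 + ‖p.1‖ + ‖p.2‖) P := by
    refine ⟨hw_cont.aestronglyMeasurable, ?_⟩
    have hnn : ∀ n p, 0 ≤ χ n p * (1 + ‖p.1‖ + ‖p.2‖) := fun n p =>
      mul_nonneg (hχ_mem n p).1 (by positivity)
    have hle : ∀ n, ∫⁻ p, ‖χ n p * (1 + ‖p.1‖ + ‖p.2‖)‖ₑ ∂P ≤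
        ENNReal.ofReal (L fun p => 1 + ‖p.1‖ + ‖p.2‖) := by
      intro n
      rw [← ofReal_integral_norm_eq_lintegral_enorm (hχ_int _ hw_cont n).1]
      simp_rw [Real.norm_of_nonneg (hnn n _)]
      rw [(hχ_int _ hw_cont n).2]
      refine ENNReal.ofReal_le_ofReal (hmono _ (hχ_growth _ hw_mem n) _ hw_mem fun p => ?_)
      exact mul_le_of_le_one_left (by positivity) (hχ_mem n p).2
    calc ∫⁻ p, ‖1 + ‖p.1‖ + ‖p.2‖‖ₑ ∂P
        = ∫⁻ p, liminf (fun n => ‖χ n p * (1 + ‖p.1‖ + ‖p.2‖)‖ₑ) atTop ∂P :=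
          lintegral_congr fun p =>
            ((hχ_lim (fun p => 1 + ‖p.1‖ + ‖p.2‖) p).enorm.liminf_eq).symm
      _ ≤ liminf (fun n => ∫⁻ p, ‖χ n p * (1 + ‖p.1‖ + ‖p.2‖)‖ₑ ∂P) atTop :=
          lintegral_liminf_le' fun n =>
            (hχ_int _ hw_cont n).1.aestronglyMeasurable.aemeasurable.enorm
      _ ≤ ENNReal.ofReal (L fun p => 1 + ‖p.1‖ + ‖p.2‖) :=
          liminf_le_of_frequently_le' (Frequently.of_forall hle)
      _ < ⊤ := ENNReal.ofReal_lt_top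
  refine ⟨P, hw, fun f hf hfc => ?_⟩
  obtain ⟨K, hK⟩ := id hf
  refine tendsto_nhds_unique ?_ (hχ_L f hf)
  simp_rw [← (hχ_int f hfc _).2]
  exact tendsto_integral_of_dominated_convergence (fun p => K * (1 + ‖p.1‖ + ‖p.2‖))
    (fun n => (hχ_int f hfc n).1.aestronglyMeasurable) (hw.const_mul K)
    (fun n => Eventually.of_forall fun p => (hχ_le f n p).trans (hK p))
    (Eventually.of_forall fun p => hχ_lim f p)

end Representation

section Dual

variable {E : Type*} [NormedAddCommGroup E] [InnerProductSpace ℝ E] [MeasurableSpace E]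

/-- The values of the dual problem: the costs of the triples `(u1, u2, h)` superhedging `f`. -/
def dualValues (μ1 μ2 : Measure E) (f : E × E → ℝ) : Set ℝ :=
  {r : ℝ | ∃ (u1 u2 : E → ℝ) (h : E →ᵇ E),
    Integrable u1 μ1 ∧ Integrable u2 μ2 ∧
    (∀ s1 s2 : E, f (s1, s2) ≤ u1 s1 + u2 s2 + ⟪h s1, s2 - s1⟫) ∧
    r = ∫ x, u1 x ∂μ1 + ∫ x, u2 x ∂μ2}

variable {μ1 μ2 : Measure E} {f g : E × E → ℝ} {r s t : ℝ}

theorem add_mem_dualValues (hr : r ∈ dualValues μ1 μ2 f) (hs : s ∈ dualValues μ1 μ2 g) :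
    r + s ∈ dualValues μ1 μ2 (f + g) := by
  obtain ⟨u1, u2, h, hu1, hu2, hle, rfl⟩ := hr
  obtain ⟨v1, v2, k, hv1, hv2, hle', rfl⟩ := hs
  refine ⟨u1 + v1, u2 + v2, h + k, hu1.add hv1, hu2.add hv2, fun s1 s2 => ?_, ?_⟩
  · have := hle s1 s2
    have := hle' s1 s2
    simp only [Pi.add_apply, BoundedContinuousFunction.coe_add, inner_add_left]
    linarith
  · simp only [Pi.add_apply]
    rw [integral_add hu1 hv1, integral_add hu2 hv2]
    ring

theorem smul_mem_dualValues (ht : 0 ≤ t) (hr : r ∈ dualValues μ1 μ2 f) :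
    t * r ∈ dualValues μ1 μ2 (t • f) := by
  obtain ⟨u1, u2, h, hu1, hu2, hle, rfl⟩ := hr
  refine ⟨t • u1, t • u2, t • h, hu1.smul t, hu2.smul t, fun s1 s2 => ?_, ?_⟩
  · have := mul_le_mul_of_nonneg_left (hle s1 s2) ht
    simp only [Pi.smul_apply, BoundedContinuousFunction.coe_smul, real_inner_smul_left,
      smul_eq_mul]
    linarith
  · simp only [Pi.smul_apply, smul_eq_mul]
    rw [integral_const_mul, integral_const_mul]
    ring

theorem dualValues_nonempty [IsFiniteMeasure μ1] [IsFiniteMeasure μ2]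
    (hμ1 : Integrable (fun x => ‖x‖) μ1) (hμ2 : Integrable (fun x => ‖x‖) μ2)
    (hf : f ∈ linearGrowth E) : (dualValues μ1 μ2 f).Nonempty := by
  obtain ⟨K, hK⟩ := hf
  refine ⟨_, fun x => K * (1 + ‖x‖), fun x => K * ‖x‖, 0,
    ((integrable_const 1).add hμ1).const_mul K, hμ2.const_mul K, fun s1 s2 => ?_, rfl⟩
  have := (le_abs_self _).trans (hK (s1, s2))
  simp only [BoundedContinuousFunction.coe_zero, Pi.zero_apply, inner_zero_left]
  linarith

/-- Under the convex order, superhedging a nonnegative payoff has nonnegative cost. -/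
theorem nonneg_of_mem_dualValues [BorelSpace E] [SecondCountableTopology E]
    [IsFiniteMeasure μ1] [IsFiniteMeasure μ2]
    (hμ1 : Integrable (fun x => ‖x‖) μ1) (hμ2 : Integrable (fun x => ‖x‖) μ2)
    (hconv : ∀ φ : E → ℝ, ConvexOn ℝ Set.univ φ →
      Integrable φ μ1 → Integrable φ μ2 → ∫ x, φ x ∂μ1 ≤ ∫ x, φ x ∂μ2)
    (hr : r ∈ dualValues μ1 μ2 0) : 0 ≤ r := by
  obtain ⟨u1, u2, h, hu1, hu2, hle, rfl⟩ := hr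
  let φ : E → ℝ := fun y => ⨆ x, (-u1 x - ⟪h x, y - x⟫)
  have hub : ∀ y x, -u1 x - ⟪h x, y - x⟫ ≤ u2 y := by
    intro y x
    have := hle x y
    simp only [Pi.zero_apply] at this
    linarith
  have hbdd : ∀ y, BddAbove (Set.range fun x => -u1 x - ⟪h x, y - x⟫) := fun y =>
    ⟨u2 y, Set.forall_mem_range.2 (hub y)⟩
  have hφ_ge : ∀ y x, -u1 x - ⟪h x, y - x⟫ ≤ φ y := fun y x => le_ciSup (hbdd y) x
  have hφ_le : ∀ y, φ y ≤ u2 y := fun y => ciSup_le (hub y)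
  have hφ_conv : ConvexOn ℝ Set.univ φ := by
    refine ⟨convex_univ, fun y _ z _ a b ha hb hab => ciSup_le fun x => ?_⟩
    have h1 := mul_le_mul_of_nonneg_left (hφ_ge y x) ha
    have h2 := mul_le_mul_of_nonneg_left (hφ_ge z x) hb
    have h3 : ⟪h x, a • y + b • z - x⟫ = a * ⟪h x, y - x⟫ + b * ⟪h x, z - x⟫ := by
      rw [← real_inner_smul_right, ← real_inner_smul_right, ← inner_add_right]
      congr 1
      rw [smul_sub, smul_sub, sub_add_sub_comm, ← add_smul, hab, one_smul]
    have h4 : u1 x = a * u1 x + b * u1 x := by rw [← add_mul, hab, one_mul]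
    simp only [smul_eq_mul]
    linarith
  have hφ_lip : LipschitzWith ‖h‖₊ φ := by
    refine LipschitzWith.of_le_add_mul _ fun y z => ciSup_le fun x => ?_
    have h1 := hφ_ge z x
    have h2 : ⟪h x, z - x⟫ - ⟪h x, y - x⟫ ≤ ‖h‖ * dist y z := by
      rw [← inner_sub_right, sub_sub_sub_cancel_right, dist_comm, dist_eq_norm]
      exact (real_inner_le_norm _ _).trans
        (mul_le_mul_of_nonneg_right (h.norm_coe_le_norm x) (norm_nonneg _))
    simp only [coe_nnnorm]
    linarith
  have hφ1 := integrable_of_lipschitz hμ1 hφ_lip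
  have hφ2 := integrable_of_lipschitz hμ2 hφ_lip
  have h1 : ∫ x, -u1 x ∂μ1 ≤ ∫ x, φ x ∂μ1 :=
    integral_mono hu1.neg hφ1 fun x => by simpa using hφ_ge x x
  have h2 : ∫ x, φ x ∂μ2 ≤ ∫ x, u2 x ∂μ2 := integral_mono hφ2 hu2 hφ_le
  rw [integral_neg] at h1
  linarith [hconv φ hφ_conv hφ1 hφ2]

theorem dualValues_bddBelow [BorelSpace E] [SecondCountableTopology E]
    [IsFiniteMeasure μ1] [IsFiniteMeasure μ2]
    (hμ1 : Integrable (fun x => ‖x‖) μ1) (hμ2 : Integrable (fun x => ‖x‖) μ2)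
    (hconv : ∀ φ : E → ℝ, ConvexOn ℝ Set.univ φ →
      Integrable φ μ1 → Integrable φ μ2 → ∫ x, φ x ∂μ1 ≤ ∫ x, φ x ∂μ2)
    (hf : f ∈ linearGrowth E) : BddBelow (dualValues μ1 μ2 f) := by
  obtain ⟨s, hs⟩ := dualValues_nonempty hμ1 hμ2 (neg_mem hf)
  refine ⟨-s, fun r hr => ?_⟩
  have h := add_mem_dualValues hr hs
  rw [add_neg_cancel] at h
  linarith [nonneg_of_mem_dualValues hμ1 hμ2 hconv h]

/-- The dual value at `f` is attained by a linear functional below the superhedging cost. -/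
theorem exists_linearMap_le_dualValues [BorelSpace E] [SecondCountableTopology E]
    [IsFiniteMeasure μ1] [IsFiniteMeasure μ2]
    (hμ1 : Integrable (fun x => ‖x‖) μ1) (hμ2 : Integrable (fun x => ‖x‖) μ2)
    (hconv : ∀ φ : E → ℝ, ConvexOn ℝ Set.univ φ →
      Integrable φ μ1 → Integrable φ μ2 → ∫ x, φ x ∂μ1 ≤ ∫ x, φ x ∂μ2)
    (hf : f ∈ linearGrowth E) :
    ∃ L : (E × E → ℝ) →ₗ[ℝ] ℝ, L f = sInf (dualValues μ1 μ2 f) ∧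
      ∀ g ∈ linearGrowth E, ∀ r ∈ dualValues μ1 μ2 g, L g ≤ r := by
  have hne : ∀ g : linearGrowth E, (dualValues μ1 μ2 (g : E × E → ℝ)).Nonempty :=
    fun g => dualValues_nonempty hμ1 hμ2 g.2
  have hbdd : ∀ g : linearGrowth E, BddBelow (dualValues μ1 μ2 (g : E × E → ℝ)) :=
    fun g => dualValues_bddBelow hμ1 hμ2 hconv g.2
  let N : linearGrowth E → ℝ := fun g => sInf (dualValues μ1 μ2 (g : E × E → ℝ))
  have N_smul_le : ∀ t : ℝ, 0 < t → ∀ g, N (t • g) ≤ t * N g := by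
    intro t ht g
    rw [← div_le_iff₀' ht]
    refine le_csInf (hne g) fun r hr => ?_
    rw [div_le_iff₀' ht]
    exact csInf_le (hbdd _) (smul_mem_dualValues ht.le hr)
  obtain ⟨L, hLf, hL⟩ := exists_linearMap_eq_of_sublinear N
    (fun t ht g => by
      refine le_antisymm (N_smul_le t ht g) ?_
      have h := N_smul_le t⁻¹ (inv_pos.2 ht) (t • g)
      rwa [inv_smul_smul₀ ht.ne', ← div_eq_inv_mul, le_div_iff₀' ht] at h)
    (fun g k => by
      refine le_of_forall_pos_lt_add fun ε hε => ?_
      obtain ⟨r, hr, hr'⟩ := exists_lt_of_csInf_lt (hne g)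
        (lt_add_of_pos_right (N g) (half_pos hε))
      obtain ⟨s, hs, hs'⟩ := exists_lt_of_csInf_lt (hne k)
        (lt_add_of_pos_right (N k) (half_pos hε))
      have : N (g + k) ≤ r + s := csInf_le (hbdd _) (add_mem_dualValues hr hs)
      linarith) ⟨f, hf⟩
  obtain ⟨L', hL'⟩ := L.exists_extend
  have hL'_apply : ∀ g : linearGrowth E, L' g = L g := fun g => LinearMap.congr_fun hL' g
  refine ⟨L', (hL'_apply ⟨f, hf⟩).trans hLf, fun g hg r hr => ?_⟩
  rw [hL'_apply ⟨g, hg⟩]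
  exact (hL ⟨g, hg⟩).trans (csInf_le (hbdd ⟨g, hg⟩) hr)

/-- A functional below the superhedging cost is exact on perfectly hedged payoffs. -/
theorem eq_of_le_dualValues {L : (E × E → ℝ) →ₗ[ℝ] ℝ}
    (hL : ∀ g ∈ linearGrowth E, ∀ r ∈ dualValues μ1 μ2 g, L g ≤ r) (hf : f ∈ linearGrowth E)
    {u1 u2 : E → ℝ} (h : E →ᵇ E) (hu1 : Integrable u1 μ1) (hu2 : Integrable u2 μ2)
    (heq : ∀ s1 s2, f (s1, s2) = u1 s1 + u2 s2 + ⟪h s1, s2 - s1⟫) :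
    L f = ∫ x, u1 x ∂μ1 + ∫ x, u2 x ∂μ2 := by
  refine le_antisymm (hL f hf _ ⟨u1, u2, h, hu1, hu2, fun s1 s2 => (heq s1 s2).le, rfl⟩) ?_
  have := hL (-f) (neg_mem hf) _ ⟨-u1, -u2, -h, hu1.neg, hu2.neg, fun s1 s2 => by
    simp only [Pi.neg_apply, BoundedContinuousFunction.coe_neg, inner_neg_left, heq]
    linarith, rfl⟩
  simp only [map_neg, Pi.neg_apply, integral_neg] at this
  linarith

/-- Weak duality. -/
theorem integral_le_of_mem_dualValues {P : Measure (E × E)} [BorelSpace E]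
    [SecondCountableTopology E] (h1 : P.map Prod.fst = μ1) (h2 : P.map Prod.snd = μ2)
    (hP : Integrable (fun p : E × E => ‖p.1‖ + ‖p.2‖) P)
    (hmart : ∀ h : E →ᵇ E, ∫ p : E × E, ⟪h p.1, p.2 - p.1⟫ ∂P = 0)
    (hf : Integrable f P) (hr : r ∈ dualValues μ1 μ2 f) : ∫ p, f p ∂P ≤ r := by
  obtain ⟨u1, u2, h, hu1, hu2, hle, rfl⟩ := hr
  subst h1 h2
  have hi1 : Integrable (fun p : E × E => u1 p.1) P := hu1.comp_measurable measurable_fst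
  have hi2 : Integrable (fun p : E × E => u2 p.2) P := hu2.comp_measurable measurable_snd
  have hi3 : Integrable (fun p : E × E => ⟪h p.1, p.2 - p.1⟫) P := by
    have hcont : Continuous (fun p : E × E => ⟪h p.1, p.2 - p.1⟫) := by fun_prop
    refine (hP.const_mul ‖h‖).mono' hcont.aestronglyMeasurable (Eventually.of_forall fun p => ?_)
    refine (norm_inner_le_norm _ _).trans (mul_le_mul (h.norm_coe_le_norm _) ?_
      (norm_nonneg _) (norm_nonneg _))
    linarith [norm_sub_le p.2 p.1]
  calc ∫ p, f p ∂P ≤ ∫ p, u1 p.1 + u2 p.2 + ⟪h p.1, p.2 - p.1⟫ ∂P :=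
        integral_mono hf ((hi1.add hi2).add hi3) fun p => hle p.1 p.2
    _ = _ := by
        rw [integral_add (f := fun p : E × E => u1 p.1 + u2 p.2) (hi1.add hi2) hi3,
          integral_add hi1 hi2, hmart h, add_zero,
          integral_map measurable_fst.aemeasurable hu1.aestronglyMeasurable,
          integral_map measurable_snd.aemeasurable hu2.aestronglyMeasurable]

/-- Strong duality with primal attainment. -/
theorem exists_martingale_coupling_sInf_le [BorelSpace E] [FiniteDimensional ℝ E]
    [IsProbabilityMeasure μ1] [IsProbabilityMeasure μ2]
    (hμ1 : Integrable (fun x => ‖x‖) μ1) (hμ2 : Integrable (fun x => ‖x‖) μ2)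
    (hconv : ∀ φ : E → ℝ, ConvexOn ℝ Set.univ φ →
      Integrable φ μ1 → Integrable φ μ2 → ∫ x, φ x ∂μ1 ≤ ∫ x, φ x ∂μ2)
    {c : E × E → ℝ} (hc : UpperSemicontinuous c) (hc' : c ∈ linearGrowth E) :
    ∃ P : Measure (E × E), IsProbabilityMeasure P ∧
      P.map Prod.fst = μ1 ∧ P.map Prod.snd = μ2 ∧
      Integrable (fun p : E × E => ‖p.1‖ + ‖p.2‖) P ∧
      (∀ h : E →ᵇ E, ∫ p : E × E, ⟪h p.1, p.2 - p.1⟫ ∂P = 0) ∧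
      sInf (dualValues μ1 μ2 c) ≤ ∫ p, c p ∂P := by
  have : ProperSpace E := FiniteDimensional.proper_real E
  obtain ⟨L, hLc, hL⟩ := exists_linearMap_le_dualValues hμ1 hμ2 hconv hc'
  have hpos : ∀ f ∈ linearGrowth E, (∀ p, 0 ≤ f p) → 0 ≤ L f := by
    intro f hf hf0
    have := hL (-f) (neg_mem hf) 0 ⟨0, 0, 0, integrable_zero _ _ _, integrable_zero _ _ _,
      fun s1 s2 => by simpa using hf0 (s1, s2), by simp⟩
    rw [map_neg] at this
    linarith
  have hexc : ∀ {μ : Measure E}, Integrable (fun x => ‖x‖) μ → ∀ n : ℕ,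
      Integrable (fun x : E => max (‖x‖ - n) 0) μ := by
    intro μ hμ n
    have hcont : Continuous fun x : E => max (‖x‖ - n) 0 := by fun_prop
    refine hμ.mono' hcont.aestronglyMeasurable (Eventually.of_forall fun x => ?_)
    rw [Real.norm_of_nonneg (le_max_right _ _)]
    exact max_le (by simp) (norm_nonneg _)
  have htail : Tendsto (fun n => L (normExcess n)) atTop (𝓝 0) := by
    have h := (tendsto_integral_norm_sub_nat hμ1).add (tendsto_integral_norm_sub_nat hμ2)
    rw [add_zero] at h
    refine h.congr fun n => ?_
    exact (eq_of_le_dualValues hL (normExcess_mem_linearGrowth n) 0 (hexc hμ1 n) (hexc hμ2 n)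
      fun s1 s2 => by simp [normExcess]).symm
  obtain ⟨P, hPw, hP⟩ := exists_measure_integral_eq L hpos htail
  have hfin : IsFiniteMeasure P := by
    have h1 : Integrable (fun _ : E × E => (1 : ℝ)) P :=
      hPw.mono' aestronglyMeasurable_const (Eventually.of_forall fun p => by
        have := norm_nonneg p.1
        have := norm_nonneg p.2
        rw [norm_one]
        linarith)
    exact (integrable_const_iff.1 h1).resolve_left one_ne_zero
  have hfst : P.map Prod.fst = μ1 := by
    refine ext_of_forall_integral_eq_of_IsFiniteMeasure fun u => ?_
    have hmem : (fun p : E × E => u p.1) ∈ linearGrowth E :=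
      mem_linearGrowth_of_bounded fun p => u.norm_coe_le_norm p.1
    rw [integral_map measurable_fst.aemeasurable u.continuous.aestronglyMeasurable,
      hP _ hmem (by fun_prop),
      eq_of_le_dualValues hL hmem (u2 := 0) 0 (u.integrable μ1) (integrable_zero _ _ _)
        fun s1 s2 => by simp]
    simp
  have hsnd : P.map Prod.snd = μ2 := by
    refine ext_of_forall_integral_eq_of_IsFiniteMeasure fun u => ?_
    have hmem : (fun p : E × E => u p.2) ∈ linearGrowth E :=
      mem_linearGrowth_of_bounded fun p => u.norm_coe_le_norm p.2
    rw [integral_map measurable_snd.aemeasurable u.continuous.aestronglyMeasurable,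
      hP _ hmem (by fun_prop),
      eq_of_le_dualValues hL hmem (u1 := 0) 0 (integrable_zero _ _ _) (u.integrable μ2)
        fun s1 s2 => by simp]
    simp
  have hprob : IsProbabilityMeasure P := by
    constructor
    rw [← Set.preimage_univ (f := Prod.fst), ← Measure.map_apply measurable_fst .univ, hfst,
      measure_univ]
  refine ⟨P, hprob, hfst, hsnd, ?_, fun h => ?_, ?_⟩
  · exact (hPw.sub (integrable_const 1)).congr (Eventually.of_forall fun p => by
      simp only [Pi.sub_apply]
      ring)
  · have hmem : (fun p : E × E => ⟪h p.1, p.2 - p.1⟫) ∈ linearGrowth E := by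
      refine ⟨‖h‖, fun p => (abs_real_inner_le_norm _ _).trans
        (mul_le_mul (h.norm_coe_le_norm _) ?_ (norm_nonneg _) (norm_nonneg _))⟩
      linarith [norm_sub_le p.2 p.1]
    rw [hP _ hmem (by fun_prop),
      eq_of_le_dualValues hL hmem (u1 := 0) (u2 := 0) h (integrable_zero _ _ _)
        (integrable_zero _ _ _) fun s1 s2 => by simp]
    simp
  · obtain ⟨M, F, hF, hFM, hcF, hlim⟩ :=
      exists_continuous_tendsto_of_upperSemicontinuous hc hc'
    have hmem : ∀ n, F n ∈ linearGrowth E := fun n => ⟨M, hFM n⟩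
    have hconvF : Tendsto (fun n => ∫ p, F n p ∂P) atTop (𝓝 (∫ p, c p ∂P)) :=
      tendsto_integral_of_dominated_convergence (fun p => M * (1 + ‖p.1‖ + ‖p.2‖))
        (fun n => (hF n).aestronglyMeasurable) (hPw.const_mul M)
        (fun n => Eventually.of_forall (hFM n)) (Eventually.of_forall hlim)
    refine ge_of_tendsto' hconvF fun n => ?_
    have := hpos (F n - c) (sub_mem (hmem n) hc') fun p => sub_nonneg.2 (hcF n p)
    rw [map_sub, hLc] at this
    rw [hP _ (hmem n) (hF n)]
    linarith

end Dual

/-- Martingale optimal transport duality (no duality gap): for `μ1 ≤ μ2` in the convex order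
and an upper semicontinuous cost of linear growth, the supremum of `∫ c dP` over martingale
couplings equals the infimum of `∫ u1 dμ1 + ∫ u2 dμ2` over dual triples `(u1, u2, h)`. -/
theorem mot_duality {d : ℕ} (μ1 μ2 : Measure (EuclideanSpace ℝ (Fin d)))
    [IsProbabilityMeasure μ1] [IsProbabilityMeasure μ2]
    (hμ1 : Integrable (fun x => ‖x‖) μ1) (hμ2 : Integrable (fun x => ‖x‖) μ2)
    (hconv : ∀ f : EuclideanSpace ℝ (Fin d) → ℝ, ConvexOn ℝ Set.univ f →
      Integrable f μ1 → Integrable f μ2 → ∫ x, f x ∂μ1 ≤ ∫ x, f x ∂μ2)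
    (c : EuclideanSpace ℝ (Fin d) × EuclideanSpace ℝ (Fin d) → ℝ)
    (hc : UpperSemicontinuous c)
    (K : ℝ) (hK : ∀ p : EuclideanSpace ℝ (Fin d) × EuclideanSpace ℝ (Fin d),
      |c p| ≤ K * (1 + ‖p.1‖ + ‖p.2‖)) :
    sSup {r : ℝ | ∃ P : Measure (EuclideanSpace ℝ (Fin d) × EuclideanSpace ℝ (Fin d)),
        IsProbabilityMeasure P ∧ IsMartingaleCoupling μ1 μ2 P ∧ r = ∫ p, c p ∂P} =
      sInf {r : ℝ | ∃ (u1 u2 : EuclideanSpace ℝ (Fin d) → ℝ)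
          (h : EuclideanSpace ℝ (Fin d) →ᵇ EuclideanSpace ℝ (Fin d)),
        Integrable u1 μ1 ∧ Integrable u2 μ2 ∧
        (∀ s1 s2 : EuclideanSpace ℝ (Fin d), c (s1, s2) ≤ u1 s1 + u2 s2 + ⟪h s1, s2 - s1⟫) ∧
        r = ∫ x, u1 x ∂μ1 + ∫ x, u2 x ∂μ2} := by
  have hc' : c ∈ linearGrowth (EuclideanSpace ℝ (Fin d)) := ⟨K, hK⟩
  obtain ⟨P, hP, hfst, hsnd, hmom, hmart, hle⟩ :=
    exists_martingale_coupling_sInf_le hμ1 hμ2 hconv hc hc'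
  have hweak : ∀ Q : Measure (EuclideanSpace ℝ (Fin d) × EuclideanSpace ℝ (Fin d)),
      IsProbabilityMeasure Q → IsMartingaleCoupling μ1 μ2 Q →
      ∫ p, c p ∂Q ≤ sInf (dualValues μ1 μ2 c) := by
    intro Q hQ hQm
    obtain ⟨⟨hQ1, hQ2⟩, hQmom, hQmart⟩ := hQm
    have hcQ : Integrable c Q := by
      refine (((integrable_const 1).add hQmom).const_mul K).mono'
        hc.measurable.aestronglyMeasurable (Filter.Eventually.of_forall fun p => ?_)
      simpa only [Real.norm_eq_abs, Pi.add_apply, add_assoc] using hK p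
    exact le_csInf (dualValues_nonempty hμ1 hμ2 hc') fun r hr =>
      integral_le_of_mem_dualValues hQ1 hQ2 hQmom hQmart hcQ hr
  have hPm : IsMartingaleCoupling μ1 μ2 P := ⟨⟨hfst, hsnd⟩, hmom, hmart⟩
  refine IsGreatest.csSup_eq ⟨⟨P, hP, hPm, le_antisymm hle (hweak P hP hPm)⟩, ?_⟩
  rintro r ⟨Q, hQ, hQm, rfl⟩
  exact hweak Q hQ hQm
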